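/- arXiv:1908.01387 — 2 statements merged into one kernel-verified Lean document; each statement's English description precedes it below -/
import Mathlib

section
/- The set of eventually basic continuous functions is dense in the space C(X) of continuous real-valued functions on X with respect to the supremum norm: for every continuous f : X → ℝ and every ε > 0 there exists an eventually basic continuous function g : X → ℝ with sup_{x ∈ X} |f(x) − g(x)| < ε. -/
/-- The set of eventually basic continuous functions is dense in `C(X)`:
for every continuous `f : X → ℝ` and every `ε > 0` there is a continuous
`g : X → ℝ` which is eventually basic (i.e. `g = g ∘ π` on some tube
`L(δ) = {x | dist (x, L) ≤ δ}` with `δ > 0`) and `|f x - g x| < ε` for all `x`. -/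
theorem eventually_basic_dense
    {X : Type*} [MetricSpace X] [CompactSpace X]
    (L : Set X) (hLclosed : IsClosed L) (hLne : L.Nonempty)
    (π : X → X) (hπcont : Continuous π)
    (hπran : ∀ x : X, π x ∈ L) (hπfix : ∀ x ∈ L, π x = x)
    (f : X → ℝ) (hf : Continuous f) (ε : ℝ) (hε : 0 < ε) :
    ∃ g : X → ℝ, Continuous g ∧
      (∃ δ > (0 : ℝ), ∀ x : X, Metric.infDist x L ≤ δ → g x = g (π x)) ∧
      ∀ x : X, |f x - g x| < ε := by
  -- `h = f - f ∘ π` vanishes on `L`; soft-threshold it at level `ε / 2`.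
  have hh : Continuous (fun x => f x - f (π x)) := hf.sub (hf.comp hπcont)
  have hu := CompactSpace.uniformContinuous_of_continuous hh
  obtain ⟨δ, hδ, hd⟩ := Metric.uniformContinuous_iff.1 hu (ε / 2) (by linarith)
  refine ⟨fun x => f x - max (-(ε / 2)) (min (ε / 2) (f x - f (π x))), ?_, ⟨δ / 2, by linarith, ?_⟩, ?_⟩
  · exact hf.sub (continuous_const.max (continuous_const.min hh))
  · intro x hx
    obtain ⟨y, hy, hxy⟩ := (Metric.infDist_lt_iff hLne).1 (lt_of_le_of_lt hx (by linarith : δ / 2 < δ))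
    have h1 := hd hxy
    simp only [hπfix y hy, sub_self, Real.dist_eq, sub_zero] at h1
    obtain ⟨h2, h3⟩ := abs_lt.1 h1
    simp only [hπfix (π x) (hπran x), sub_self]
    rw [min_eq_right h3.le, max_eq_right h2.le, min_eq_right (by linarith), max_eq_right (by linarith)]
    ring
  · intro x
    have h1 : max (-(ε / 2)) (min (ε / 2) (f x - f (π x))) ≤ ε / 2 :=
      max_le (by linarith) (min_le_left _ _)
    have h2 := le_max_left (-(ε / 2)) (min (ε / 2) (f x - f (π x)))
    rw [sub_sub_cancel, abs_lt]
    constructor <;> linarith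
end

section
/- Fix T > 0. For each ε ∈ (0,1] let μ_ε be a Borel probability measure on the path space C([0,T], X) such that μ_ε-almost every path ω satisfies dist(ω(t), L) ≤ ε for all t ∈ [0,T]. Assume that for every ε₀ ∈ (0,1] the sub-family {μ_ε : ε₀ ≤ ε ≤ 1} is tight. Then the following are equivalent: (1) the family {Φ_π∗ μ_ε : 0 < ε ≤ 1} of pushforward measures under the continuous map Φ_π : C([0,T], X) → C([0,T], X), Φ_π(ω) = π ∘ ω, is tight; (2) the family {μ_ε : 0 < ε ≤ 1} is tight. -/
open MeasureTheory
open scoped ENNReal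

/-- Points close to `L` are moved only a little by the retraction. -/
lemma exists_tube_radius {X : Type*} [MetricSpace X] [CompactSpace X]
    (L : Set X) (hLclosed : IsClosed L) (hLne : L.Nonempty)
    (π : X → X) (hπcont : Continuous π) (hπfix : ∀ x ∈ L, π x = x) (r : ℝ) (hr : 0 < r) :
    ∃ δ ∈ Set.Ioc (0 : ℝ) 1, ∀ x, Metric.infDist x L < δ → dist x (π x) ≤ r := by
  have hc : IsCompact {x : X | r ≤ dist x (π x)} :=
    (isClosed_le continuous_const (continuous_id.dist hπcont)).isCompact
  rcases Set.eq_empty_or_nonempty {x : X | r ≤ dist x (π x)} with he | hne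
  · refine ⟨1, by simp, fun x _ => ?_⟩
    by_contra h
    have : x ∈ {x : X | r ≤ dist x (π x)} := (not_le.1 h).le
    rw [he] at this
    exact this
  · obtain ⟨y, hy, hmin⟩ := hc.exists_isMinOn hne
      (Metric.continuous_infDist_pt L).continuousOn
    have hpos : 0 < Metric.infDist y L := by
      refine lt_of_le_of_ne Metric.infDist_nonneg fun h => ?_
      have hyL : y ∈ L := (hLclosed.mem_iff_infDist_zero hLne).2 h.symm
      have hy' : r ≤ dist y (π y) := hy
      rw [hπfix y hyL, dist_self] at hy'
      linarith
    refine ⟨min (Metric.infDist y L) 1, ⟨lt_min hpos one_pos, min_le_right _ _⟩, fun x hx => ?_⟩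
    by_contra h
    have h1 : Metric.infDist y L ≤ Metric.infDist x L := hmin (not_le.1 h).le
    have h2 := lt_of_lt_of_le hx (min_le_left _ _)
    linarith

/-- Tightness of the conditioned processes is equivalent to tightness of their
projections onto `L`.  Here `μ ε` is a probability measure on the path space
`C([0,T], X)` supported (a.e.) by paths staying in the `ε`-tube around `L`, the
sub-families `{μ ε : ε₀ ≤ ε ≤ 1}` are assumed tight for every `ε₀ ∈ (0,1]`, and
`Φ_π` is the pushforward by the map `ω ↦ π ∘ ω` on path space. -/
theorem tight_iff_tight_of_projections
    {X : Type*} [MetricSpace X] [CompactSpace X]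
    (L : Set X) (hLclosed : IsClosed L) (hLne : L.Nonempty)
    (π : X → X) (hπcont : Continuous π)
    (hπran : ∀ x : X, π x ∈ L) (hπfix : ∀ x ∈ L, π x = x)
    (T : ℝ) (hT : 0 < T)
    [MeasurableSpace C(Set.Icc (0 : ℝ) T, X)] [BorelSpace C(Set.Icc (0 : ℝ) T, X)]
    (μ : ℝ → Measure C(Set.Icc (0 : ℝ) T, X))
    (hprob : ∀ ε ∈ Set.Ioc (0 : ℝ) 1, IsProbabilityMeasure (μ ε))
    (hsupp : ∀ ε ∈ Set.Ioc (0 : ℝ) 1, ∀ᵐ ω ∂(μ ε),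
      ∀ t : Set.Icc (0 : ℝ) T, Metric.infDist (ω t) L ≤ ε)
    (htail : ∀ ε₀ ∈ Set.Ioc (0 : ℝ) 1, ∀ η : ℝ≥0∞, 0 < η →
      ∃ K : Set C(Set.Icc (0 : ℝ) T, X), IsCompact K ∧
        ∀ ε : ℝ, ε₀ ≤ ε → ε ≤ 1 → μ ε Kᶜ ≤ η) :
    (∀ η : ℝ≥0∞, 0 < η → ∃ K : Set C(Set.Icc (0 : ℝ) T, X), IsCompact K ∧
        ∀ ε : ℝ, 0 < ε → ε ≤ 1 →
          Measure.map (fun ω : C(Set.Icc (0 : ℝ) T, X) =>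
            (ContinuousMap.mk π hπcont).comp ω) (μ ε) Kᶜ ≤ η) ↔
    (∀ η : ℝ≥0∞, 0 < η → ∃ K : Set C(Set.Icc (0 : ℝ) T, X), IsCompact K ∧
        ∀ ε : ℝ, 0 < ε → ε ≤ 1 → μ ε Kᶜ ≤ η) := by
  have hcont : Continuous (fun ω : C(Set.Icc (0 : ℝ) T, X) =>
      (ContinuousMap.mk π hπcont).comp ω) := ContinuousMap.continuous_postcomp _
  constructor
  · intro H η hη
    have hη2 : 0 < η / 2 := ENNReal.half_pos hη.ne'
    obtain ⟨K0, hK0, hK0m⟩ := H (η / 2) hη2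
    obtain ⟨e, he, hesum⟩ := ENNReal.exists_pos_sum_of_countable' hη2.ne' ℕ
    have hr : ∀ n : ℕ, (0 : ℝ) < 1 / ((n : ℝ) + 1) := fun n => Nat.one_div_pos_of_nat
    choose δ hδ hδr using fun n : ℕ =>
      exists_tube_radius L hLclosed hLne π hπcont hπfix (1 / ((n : ℝ) + 1)) (hr n)
    choose K hK hKm using fun n : ℕ => htail (δ n) (hδ n) (e n) (he n)
    let B : ℕ → Set C(Set.Icc (0 : ℝ) T, X) := fun n =>
      K n ∪ {ω | ∀ t, dist (ω t) (π (ω t)) ≤ 1 / ((n : ℝ) + 1)}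
    let A : Set C(Set.Icc (0 : ℝ) T, X) :=
      {ω | (ContinuousMap.mk π hπcont).comp ω ∈ K0} ∩ ⋂ n, B n
    have hAtb : TotallyBounded A := by
      rw [Metric.totallyBounded_iff]
      intro r hrpos
      obtain ⟨n, hn⟩ := exists_nat_one_div_lt (half_pos hrpos)
      obtain ⟨s, hs, hsc⟩ := Metric.totallyBounded_iff.1 (hK0.union (hK n)).totallyBounded
        (r / 2) (half_pos hrpos)
      refine ⟨s, hs, fun ω hω => ?_⟩
      have hωn : ω ∈ B n := Set.mem_iInter.1 hω.2 n
      rcases hωn with h | h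
      · obtain ⟨y, hy, hd⟩ := Set.mem_iUnion₂.1 (hsc (Or.inr h))
        exact Set.mem_iUnion₂.2 ⟨y, hy, Metric.ball_subset_ball (by linarith) hd⟩
      · obtain ⟨y, hy, hd⟩ := Set.mem_iUnion₂.1 (hsc (Or.inl hω.1))
        refine Set.mem_iUnion₂.2 ⟨y, hy, ?_⟩
        have h1 : dist ω ((ContinuousMap.mk π hπcont).comp ω) ≤ 1 / ((n : ℝ) + 1) :=
          (ContinuousMap.dist_le (hr n).le).2 h
        have h2 := dist_triangle ω ((ContinuousMap.mk π hπcont).comp ω) y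
        rw [Metric.mem_ball] at hd ⊢
        linarith
    refine ⟨closure A, hAtb.closure.isCompact_of_isClosed isClosed_closure, ?_⟩
    intro ε hε0 hε1
    have hB : ∀ n, μ ε (B n)ᶜ ≤ e n := by
      intro n
      rcases le_or_gt (δ n) ε with h | h
      · exact (measure_mono (Set.compl_subset_compl.2 Set.subset_union_left)).trans
          (hKm n ε h hε1)
      · have : μ ε (B n)ᶜ = 0 := by
          change ∀ᵐ ω ∂(μ ε), ω ∈ B n
          filter_upwards [hsupp ε ⟨hε0, hε1⟩] with ω hω
          exact Or.inr fun t => hδr n _ ((hω t).trans_lt h)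
        rw [this]
        exact zero_le
    have hP : μ ε {ω | (ContinuousMap.mk π hπcont).comp ω ∈ K0}ᶜ ≤ η / 2 := by
      have := hK0m ε hε0 hε1
      rwa [Measure.map_apply hcont.measurable hK0.isClosed.measurableSet.compl] at this
    calc μ ε (closure A)ᶜ ≤ μ ε Aᶜ := measure_mono (Set.compl_subset_compl.2 subset_closure)
      _ = μ ε ({ω | (ContinuousMap.mk π hπcont).comp ω ∈ K0}ᶜ ∪ ⋃ n, (B n)ᶜ) := by
          simp only [A, Set.compl_inter, Set.compl_iInter]
      _ ≤ μ ε {ω | (ContinuousMap.mk π hπcont).comp ω ∈ K0}ᶜ + μ ε (⋃ n, (B n)ᶜ) :=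
          measure_union_le _ _
      _ ≤ η / 2 + ∑' n, e n :=
          add_le_add hP ((measure_iUnion_le _).trans (ENNReal.tsum_le_tsum hB))
      _ ≤ η / 2 + η / 2 := by gcongr
      _ = η := ENNReal.add_halves η
  · intro H η hη
    obtain ⟨K, hK, hKm⟩ := H η hη
    refine ⟨_, hK.image hcont, fun ε h0 h1 => ?_⟩
    rw [Measure.map_apply hcont.measurable (hK.image hcont).isClosed.measurableSet.compl]
    refine (measure_mono ?_).trans (hKm ε h0 h1)
    intro ω hω hωK
    exact hω ⟨ω, hωK, rfl⟩
end
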